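/- Let (G,ψ) be a connected and unbalanced Γ-labeled graph with G=(V,E). Then (G,ψ) is near-balanced if and only if there exist a vertex v ∈ V, an element g ∈ Γ ∖ {1_Γ}, a subset E_v' of the set E_v of edges incident to v, and a gain function ψ' equivalent to ψ such that, assuming all edges incident to v are directed towards v, ψ'(e) = 1_Γ for every e ∈ E ∖ E_v' and ψ'(e) = g for every e ∈ E_v'. -/

import Mathlib

/- Formalization of count matroids of group-labeled graphs. -/

namespace CountMatroidPaper

attribute [local instance] Classical.propDecidable

/-- A `Γ`-labeled graph: a directed multigraph with edge set `E`, vertex set `V`,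
and a gain (group label) on each edge. -/
structure GainGraph (V E Γ : Type*) where
  tail : E → V
  head : E → V
  gain : E → Γ

variable {V E Γ : Type*}

namespace GainGraph

variable [Group Γ]

/-- `V(F)`: the set of vertices incident to the edge set `F`. -/
def verts [DecidableEq V] (G : GainGraph V E Γ) (F : Finset E) : Finset V :=
  F.image G.tail ∪ F.image G.head

/-- `G.GainWalk F u w g` : there is a walk from `u` to `w` using edges of `F` whose gain is `g`. -/
inductive GainWalk (G : GainGraph V E Γ) (F : Set E) (u : V) : V → Γ → Prop
  | nil : GainWalk G F u u 1
  | fwd {w : V} {g : Γ} {e : E} : GainWalk G F u w g → e ∈ F → G.tail e = w →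
      GainWalk G F u (G.head e) (g * G.gain e)
  | bwd {w : V} {g : Γ} {e : E} : GainWalk G F u w g → e ∈ F → G.head e = w →
      GainWalk G F u (G.tail e) (g * (G.gain e)⁻¹)

/-- An edge set is balanced if every closed walk in it has identity gain. -/
def Balanced (G : GainGraph V E Γ) (F : Set E) : Prop :=
  ∀ (v : V) (g : Γ), G.GainWalk F v v g → g = 1

/-- Membership in `C(G)` : a nonempty edge set `F` such that `(V(F), F)` is connected. -/
def Connected [DecidableEq V] (G : GainGraph V E Γ) (F : Finset E) : Prop :=
  F.Nonempty ∧ ∀ u ∈ G.verts F, ∀ w ∈ G.verts F, ∃ g : Γ, G.GainWalk (↑F) u w g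

/-- The set of gains of closed walks based at `v` using edges of `F`. -/
def gains (G : GainGraph V E Γ) (F : Set E) (v : V) : Set Γ :=
  {g | G.GainWalk F v v g}

/-- `α̃(F)`: the value of `α` on (a generating set of) the subgroup `⟨F⟩_{v,ψ}` for a
vertex `v ∈ V(F)`.  For a polymatroidal `α` (invariant under conjugation and under taking
generated subgroups) this is independent of the choice of `v`. -/
noncomputable def alphaTilde (α : Set Γ → ℤ) (G : GainGraph V E Γ) (F : Finset E) : ℤ :=
  if h : F.Nonempty then α (G.gains (↑F) (G.tail h.choose)) else 0

/-- Loops at `v`. -/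
def loopsAt (G : GainGraph V E Γ) (v : V) : Set E :=
  {e | G.tail e = v ∧ G.head e = v}

/-- Unbalanced (non-identity labeled) loops at `v`, i.e. `L_v \ L_v°`. -/
def unbalancedLoopsAt (G : GainGraph V E Γ) (v : V) : Set E :=
  {e | G.tail e = v ∧ G.head e = v ∧ G.gain e ≠ 1}

/-- `E_v`: edges incident to `v`. -/
def incidentAt (G : GainGraph V E Γ) (v : V) : Set E :=
  {e | G.tail e = v ∨ G.head e = v}

/-- Non-loop edges incident to `v`. -/
def nonloopAt (G : GainGraph V E Γ) (v : V) : Set E :=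
  {e | (G.tail e = v ∨ G.head e = v) ∧ G.tail e ≠ G.head e}

/-- The split of `(G,ψ)` at `v` with respect to the bipartition `{E₁, E₂}` of the non-loop
edges incident to `v`, where `B = E₂`: the vertex `v` is split into `v₁ = Sum.inl v` and
`v₂ = Sum.inr ()`; edges in `B` become incident to `v₂`, the remaining non-loop edges at `v`
to `v₁`; balanced loops at `v` stay loops at `v₁`, and unbalanced loops at `v` become arcs
from `v₁` to `v₂`, keeping the labeling. -/
noncomputable def split (G : GainGraph V E Γ) (v : V) (B : Set E) :
    GainGraph (V ⊕ Unit) E Γ where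
  tail e :=
    if G.tail e = v ∧ G.head e = v then Sum.inl v
    else if G.tail e = v ∧ e ∈ B then Sum.inr ()
    else Sum.inl (G.tail e)
  head e :=
    if G.tail e = v ∧ G.head e = v then
      (if G.gain e = 1 then Sum.inl v else Sum.inr ())
    else if G.head e = v ∧ e ∈ B then Sum.inr ()
    else Sum.inl (G.head e)
  gain := G.gain

/-- `v` is a base for the near-balancedness of `F`, witnessed by the part `B` of the
bipartition of the non-loop edges at `v`: the corresponding split makes `F` balanced. -/
def IsSplitBase (G : GainGraph V E Γ) (F : Finset E) (v : V) (B : Set E) : Prop :=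
  B ⊆ G.nonloopAt v ∧ Balanced (G.split v B) (↑F)

/-- A connected edge set is near-balanced if it is unbalanced and some split of `(G,ψ)`
makes it balanced. -/
def NearBalanced (G : GainGraph V E Γ) (F : Finset E) : Prop :=
  ¬ G.Balanced (↑F) ∧ ∃ (v : V) (B : Set E), G.IsSplitBase F v B

/-- `K` is an extra edge set for the near-balancedness of `F` with base `v`:
`K = E₂ ∪ (L_v \ L_v°)` (or `E₁ ∪ (L_v \ L_v°)`) for a balanced split at `v` with
bipartition `{E₁, E₂}`. -/
def ExtraEdgeSet (G : GainGraph V E Γ) (F : Finset E) (v : V) (K : Set E) : Prop :=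
  ∃ B : Set E, G.IsSplitBase F v B ∧
    (K = B ∪ G.unbalancedLoopsAt v ∨
     K = (G.nonloopAt v \ B) ∪ G.unbalancedLoopsAt v)

/-- `β(F)`. -/
noncomputable def beta (α : Set Γ → ℤ) (k : ℤ) [DecidableEq V]
    (G : GainGraph V E Γ) (F : Finset E) : ℤ :=
  if G.NearBalanced F then min (alphaTilde α G F) k else alphaTilde α G F

/-- `f_α(F) = k|V(F)| - ℓ + β(F)`. -/
noncomputable def fAlpha (α : Set Γ → ℤ) (k ℓ : ℤ) [DecidableEq V]
    (G : GainGraph V E Γ) (F : Finset E) : ℤ :=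
  k * ((G.verts F).card : ℤ) - ℓ + beta α k G F

/-- `I` is `f_α`-sparse: `|F| ≤ f_α(F)` for every `F ∈ C(G)` with `F ⊆ I`. -/
def Sparse (α : Set Γ → ℤ) (k ℓ : ℤ) [DecidableEq V]
    (G : GainGraph V E Γ) (I : Finset E) : Prop :=
  ∀ F : Finset E, F ⊆ I → G.Connected F → (F.card : ℤ) ≤ fAlpha α k ℓ G F

/-- `F` is `f_α`-tight: connected, `f_α`-sparse, with `|F| = f_α(F)`. -/
def Tight (α : Set Γ → ℤ) (k ℓ : ℤ) [DecidableEq V]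
    (G : GainGraph V E Γ) (F : Finset E) : Prop :=
  G.Connected F ∧ Sparse α k ℓ G F ∧ (F.card : ℤ) = fAlpha α k ℓ G F

/-- An edge set `Y` is `f_α`-full: the subgraph `(V(Y), Y)` contains a spanning connected
`f_α`-sparse subgraph `G'` with `β(E(G')) = β(Y)` and
`|E(G')| ≥ k|V(G')| - ℓ + min{β(E(G')), 2k - ℓ + 1}`. -/
def Full (α : Set Γ → ℤ) (k ℓ : ℤ) [DecidableEq V]
    (G : GainGraph V E Γ) (Y : Finset E) : Prop :=
  ∃ E' : Finset E, E' ⊆ Y ∧ G.Connected E' ∧ G.verts E' = G.verts Y ∧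
    Sparse α k ℓ G E' ∧ beta α k G E' = beta α k G Y ∧
    k * ((G.verts E').card : ℤ) - ℓ + min (beta α k G E') (2 * k - ℓ + 1) ≤ (E'.card : ℤ)

/-- The graph `(G,ψ)` is `f_α`-full: it contains a spanning connected `f_α`-sparse
subgraph `G'` with `β(E(G')) = β(E(G))` and
`|E(G')| ≥ k|V(G')| - ℓ + min{β(E(G')), 2k - ℓ + 1}`. -/
def FullGraph [Fintype V] [Fintype E] [DecidableEq V]
    (α : Set Γ → ℤ) (k ℓ : ℤ) (G : GainGraph V E Γ) : Prop :=
  ∃ E' : Finset E, G.Connected E' ∧ G.verts E' = Finset.univ ∧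
    Sparse α k ℓ G E' ∧ beta α k G E' = beta α k G (Finset.univ : Finset E) ∧
    k * ((G.verts E').card : ℤ) - ℓ + min (beta α k G E') (2 * k - ℓ + 1) ≤ (E'.card : ℤ)

/-- `F` is `α`-critical: connected, near-balanced, and `α̃(F) > k`. -/
def AlphaCritical (α : Set Γ → ℤ) (k : ℤ) [DecidableEq V]
    (G : GainGraph V E Γ) (F : Finset E) : Prop :=
  G.Connected F ∧ G.NearBalanced F ∧ k < alphaTilde α G F

/-- Switching at `v` with `g`. -/
noncomputable def switch (G : GainGraph V E Γ) (v : V) (g : Γ) : GainGraph V E Γ where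
  tail := G.tail
  head := G.head
  gain e :=
    if G.tail e = v ∧ G.head e = v then g * G.gain e * g⁻¹
    else if G.tail e = v then g * G.gain e
    else if G.head e = v then G.gain e * g⁻¹
    else G.gain e

/-- Two gain functions (on the same underlying graph) are equivalent if one is obtained
from the other by a sequence of switchings. -/
def Equivalent (G G' : GainGraph V E Γ) : Prop :=
  Relation.ReflTransGen (fun H H' : GainGraph V E Γ => ∃ (v : V) (g : Γ), H' = H.switch v g) G G'

/-- The label of the edge `e`, re-oriented so that `e` is directed towards `v`. -/
noncomputable def orientTo (G : GainGraph V E Γ) (v : V) (e : E) : Γ :=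
  if G.head e = v then G.gain e else (G.gain e)⁻¹

/-- Adjacency in `G - v`. -/
def AdjAvoid (G : GainGraph V E Γ) (v u w : V) : Prop :=
  u ≠ v ∧ w ≠ v ∧ ∃ e : E, (G.tail e = u ∧ G.head e = w) ∨ (G.tail e = w ∧ G.head e = u)

/-- `S` is (the edge set of) a fraction of `v`: the subgraph of `G - L_v` induced by `v`
together with the vertex set of a connected component of `G - v`. -/
def IsFraction [Fintype E] (G : GainGraph V E Γ) (v : V) (S : Finset E) : Prop :=
  ∃ u : V, u ≠ v ∧
    S = Finset.univ.filter (fun e =>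
      ¬ (G.tail e = v ∧ G.head e = v) ∧
      (G.tail e = v ∨ Relation.ReflTransGen (G.AdjAvoid v) u (G.tail e)) ∧
      (G.head e = v ∨ Relation.ReflTransGen (G.AdjAvoid v) u (G.head e)))

/-- `I` is `(k,m)`-sparse: `|F| ≤ k|V(F)| - m` for every nonempty `F ⊆ I`. -/
def CountSparse [DecidableEq V] (G : GainGraph V E Γ) (k m : ℤ) (I : Finset E) : Prop :=
  ∀ F : Finset E, F ⊆ I → F.Nonempty → (F.card : ℤ) ≤ k * ((G.verts F).card : ℤ) - m

/-- `C` is a circuit of the `(k,m)`-count matroid `M_{k,m}(G)`: a minimal set that is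
not `(k,m)`-sparse. -/
def CountCircuit [DecidableEq V] (G : GainGraph V E Γ) (k m : ℤ) (C : Finset E) : Prop :=
  ¬ G.CountSparse k m C ∧ ∀ C' : Finset E, C' ⊆ C → C' ≠ C → G.CountSparse k m C'

end GainGraph

/-- `α : 2^Γ → ℤ` is polymatroidal. -/
structure Polymatroidal [Group Γ] (α : Set Γ → ℤ) : Prop where
  empty : α ∅ = 0
  submodular : ∀ X Y : Set Γ, α (X ∪ Y) + α (X ∩ Y) ≤ α X + α Y
  mono : ∀ X Y : Set Γ, X ⊆ Y → α X ≤ α Y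
  conj : ∀ (X : Set Γ) (γ : Γ), α ((fun x => γ * x * γ⁻¹) '' X) = α X
  clos : ∀ X : Set Γ, α ((Subgroup.closure X : Subgroup Γ) : Set Γ) = α X

/-- A polymatroidal function is normalized if `α({g}) ≠ 0` for every non-identity `g`
and `α({1}) = 0`. -/
def Normalized [Group Γ] (α : Set Γ → ℤ) : Prop :=
  (∀ g : Γ, g ≠ 1 → α {g} ≠ 0) ∧ α ({1} : Set Γ) = 0

/-- The smoothness condition: `α(S ∪ {g}) - α(S) > k` implies `S = {1}` and `g² ≠ 1`. -/
def Smooth [Group Γ] (α : Set Γ → ℤ) (k : ℤ) : Prop :=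
  ∀ (S : Set Γ) (g : Γ), S.Nonempty → k < α (S ∪ {g}) - α S →
    S = ({1} : Set Γ) ∧ g ^ 2 ≠ 1


namespace GainGraph

section Potential

variable [Group Γ] {G : GainGraph V E Γ} {F : Set E}

theorem GainWalk.trans {u v w : V} {g h : Γ} (p : G.GainWalk F u v g)
    (q : G.GainWalk F v w h) : G.GainWalk F u w (g * h) := by
  induction q with
  | nil => simpa using p
  | fwd _ he ht ih => rw [← mul_assoc]; exact .fwd ih he ht
  | bwd _ he ht ih => rw [← mul_assoc]; exact .bwd ih he ht

theorem GainWalk.of_mem {e : E} (he : e ∈ F) :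
    G.GainWalk F (G.tail e) (G.head e) (G.gain e) := by
  simpa using GainWalk.fwd (.nil (G := G) (u := G.tail e)) he rfl

theorem GainWalk.of_mem_reverse {e : E} (he : e ∈ F) :
    G.GainWalk F (G.head e) (G.tail e) (G.gain e)⁻¹ := by
  simpa using GainWalk.bwd (.nil (G := G) (u := G.head e)) he rfl

theorem GainWalk.symm {u v : V} {g : Γ} (p : G.GainWalk F u v g) :
    G.GainWalk F v u g⁻¹ := by
  induction p with
  | nil => simpa using GainWalk.nil
  | fwd _ he ht ih =>
    subst ht
    rw [mul_inv_rev]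
    exact (GainWalk.of_mem_reverse he).trans ih
  | bwd _ he ht ih =>
    subst ht
    rw [mul_inv_rev, inv_inv]
    exact (GainWalk.of_mem he).trans ih

theorem GainWalk.eq_of_potential {p : V → Γ}
    (hp : ∀ e ∈ F, G.gain e = (p (G.tail e))⁻¹ * p (G.head e)) {u v : V} {g : Γ}
    (h : G.GainWalk F u v g) : g = (p u)⁻¹ * p v := by
  induction h with
  | nil => simp
  | fwd _ he ht ih => subst ht; rw [ih, hp _ he]; group
  | bwd _ he ht ih => subst ht; rw [ih, hp _ he]; group

/-- An edge set is balanced exactly when its gains come from a potential on the vertices. -/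
theorem balanced_iff_exists_potential :
    G.Balanced F ↔ ∃ p : V → Γ, ∀ e ∈ F, G.gain e = (p (G.tail e))⁻¹ * p (G.head e) := by
  constructor
  · intro hb
    let r : Setoid V :=
      { r := fun u w => ∃ g, G.GainWalk F u w g
        iseqv := ⟨fun _ => ⟨1, .nil⟩, fun ⟨_, h⟩ => ⟨_, h.symm⟩,
          fun ⟨_, h⟩ ⟨_, h'⟩ => ⟨_, h.trans h'⟩⟩ }
    have hroot : ∀ u : V, ∃ g, G.GainWalk F (Quotient.mk r u).out u g :=
      fun u => Quotient.mk_out (s := r) u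
    choose p hp using hroot
    refine ⟨p, fun e he => ?_⟩
    have hq : Quotient.mk r (G.tail e) = Quotient.mk r (G.head e) :=
      Quotient.sound (s := r) ⟨_, .of_mem he⟩
    have hhead := hp (G.head e)
    rw [← hq] at hhead
    have h := hb _ _ (((hp (G.tail e)).trans (.of_mem he)).trans hhead.symm)
    rw [mul_inv_eq_one] at h
    rw [← h, inv_mul_cancel_left]
  · rintro ⟨p, hp⟩ v g h
    simpa using h.eq_of_potential hp

/-- Simultaneous switching at every vertex `v` with `s v`. -/
def switchAll (G : GainGraph V E Γ) (s : V → Γ) : GainGraph V E Γ where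
  tail := G.tail
  head := G.head
  gain e := s (G.tail e) * G.gain e * (s (G.head e))⁻¹

theorem switchAll_one : G.switchAll 1 = G := by
  simp [switchAll]

theorem switch_eq_switchAll (v : V) (g : Γ) :
    G.switch v g = G.switchAll (Pi.mulSingle v g) := by
  simp only [switch, switchAll, GainGraph.mk.injEq, true_and]
  funext e
  by_cases ht : G.tail e = v <;> by_cases hh : G.head e = v <;>
    simp [ht, hh]

theorem switchAll_switchAll (s t : V → Γ) :
    (G.switchAll s).switchAll t = G.switchAll (t * s) := by
  simp [switchAll, mul_assoc]

theorem equivalent_switchAll [Finite V] (s : V → Γ) : G.Equivalent (G.switchAll s) := by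
  have := Fintype.ofFinite V
  have key : ∀ A : Finset V, ∀ t : V → Γ, (∀ v ∉ A, t v = 1) →
      G.Equivalent (G.switchAll t) := by
    intro A
    induction A using Finset.induction_on with
    | empty =>
      intro t ht
      have h : t = 1 := funext fun v => ht v (Finset.notMem_empty v)
      rw [h, switchAll_one]
      exact Relation.ReflTransGen.refl
    | insert a A _ ih =>
      intro t ht
      refine (ih (Function.update t a 1) fun v hv => ?_).tail ⟨a, t a, ?_⟩
      · by_cases h : v = a
        · simp [h]
        · simpa [h] using ht v (by simp [h, hv])
      · rw [switch_eq_switchAll, switchAll_switchAll]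
        congr 1
        funext v
        by_cases h : v = a
        · subst h; simp
        · simp [h]
  exact key Finset.univ s fun v hv => absurd (Finset.mem_univ v) hv

theorem Equivalent.exists_switchAll {G' : GainGraph V E Γ} (h : G.Equivalent G') :
    ∃ s : V → Γ, G' = G.switchAll s := by
  induction h with
  | refl => exact ⟨1, switchAll_one.symm⟩
  | tail _ h ih =>
    obtain ⟨s, rfl⟩ := ih
    obtain ⟨v, g, rfl⟩ := h
    exact ⟨_, by rw [switch_eq_switchAll, switchAll_switchAll]⟩

end Potential

end GainGraph

/-- Proposition 1: a connected unbalanced `Γ`-labeled graph `(G,ψ)` is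
near-balanced iff there are a vertex `v`, a non-identity `g ∈ Γ`, a subset `E_v'` of the
edges incident to `v`, and an equivalent gain function `ψ'` such that, orienting all edges
incident to `v` towards `v`, `ψ'(e) = 1` for `e ∈ E ∖ E_v'` and `ψ'(e) = g` for `e ∈ E_v'`. -/
theorem statement8 {V E Γ : Type} [Fintype V] [DecidableEq V] [Fintype E] [DecidableEq E]
    [Group Γ] (G : GainGraph V E Γ)
    (hconn : ∀ u w : V, ∃ g : Γ, G.GainWalk Set.univ u w g)
    (hunbal : ¬ G.Balanced (Set.univ : Set E)) :
    G.NearBalanced (Finset.univ : Finset E) ↔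
      ∃ (v : V) (g : Γ), g ≠ 1 ∧ ∃ E' : Set E, E' ⊆ G.incidentAt v ∧
        ∃ G' : GainGraph V E Γ, GainGraph.Equivalent G G' ∧
          (∀ e ∈ E', G'.orientTo v e = g) ∧ ∀ e ∉ E', G'.gain e = 1 := by
  rw [GainGraph.balanced_iff_exists_potential] at hunbal
  simp only [GainGraph.NearBalanced, GainGraph.IsSplitBase, Finset.coe_univ,
    GainGraph.balanced_iff_exists_potential, hunbal, not_false_eq_true, true_and]
  constructor
  · rintro ⟨v, B, hB, p, hp⟩
    obtain ⟨s, hs⟩ : ∃ s : V → Γ, ∀ u, p (Sum.inl u) = s u := ⟨_, fun _ => rfl⟩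
    have hpe := fun e => hp e trivial
    simp only [GainGraph.split] at hpe
    refine ⟨v, p (Sum.inr ()) * (s v)⁻¹, ?_, B ∪ G.unbalancedLoopsAt v, ?_,
      G.switchAll s, GainGraph.equivalent_switchAll s, ?_, ?_⟩
    · intro hg
      have hg' : p (Sum.inr ()) = s v := mul_inv_eq_one.mp hg
      refine hunbal ⟨s, fun e _ => ?_⟩
      rw [hpe e]
      congr 2
      · split_ifs with h h'
        · simp [h, hs]
        · simp [h', hg']
        · exact hs _
      · split_ifs with h h' h' <;> simp [h, h', hs, hg']
    · rintro e (he | he)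
      · exact (hB he).1
      · exact Or.inl he.1
    · rintro e (he | ⟨ht, hh, hg⟩)
      · obtain ⟨h | h, hne⟩ := hB he
        · have hh : G.head e ≠ v := fun h' => hne (h.trans h'.symm)
          have h1 := hpe e
          simp only [h, hh, he] at h1
          simp at h1
          simp [GainGraph.orientTo, GainGraph.switchAll, h, hh, h1, hs, mul_assoc]
        · have hh : G.tail e ≠ v := fun h' => hne (h'.trans h.symm)
          have h1 := hpe e
          simp only [h, hh, he] at h1
          simp at h1
          simp [GainGraph.orientTo, GainGraph.switchAll, h, h1, hs]
      · have h1 := hpe e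
        simp only [ht, hh, hg] at h1
        simp at h1
        simp [GainGraph.orientTo, GainGraph.switchAll, ht, hh, h1, hs]
    · intro e he
      have heB : e ∉ B := fun h => he (Or.inl h)
      have h1 := hpe e
      simp only [heB, and_false, if_false] at h1
      by_cases hl : G.tail e = v ∧ G.head e = v
      · have hg : G.gain e = 1 := by
          by_contra hg
          exact he (Or.inr ⟨hl.1, hl.2, hg⟩)
        simp [GainGraph.switchAll, hl.1, hl.2, hg]
      · simp only [hl, if_false] at h1
        simp [GainGraph.switchAll, h1, hs]
  · rintro ⟨v, g, hg, E', hE', G', hG', hE'g, hE'1⟩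
    obtain ⟨s, rfl⟩ := hG'.exists_switchAll
    refine ⟨v, E' ∩ G.nonloopAt v, Set.inter_subset_right,
      Sum.elim s fun _ => g * s v, fun e _ => ?_⟩
    have hgain : G.gain e = (s (G.tail e))⁻¹ * (G.switchAll s).gain e * s (G.head e) := by
      simp [GainGraph.switchAll, mul_assoc]
    change G.gain e = _
    simp only [GainGraph.split]
    by_cases he : e ∈ E'
    · have h1 := hE'g e he
      have hinc := hE' he
      by_cases ht : G.tail e = v <;> by_cases hh : G.head e = v
      · have h2 : (G.switchAll s).gain e = g := by
          simpa [GainGraph.orientTo, GainGraph.switchAll, hh] using h1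
        have h3 : G.gain e ≠ 1 := by
          rw [hgain, h2, ht, hh]
          intro h
          apply hg
          simpa [mul_assoc, inv_mul_eq_one] using h
        simp only [ht, hh, h3]
        rw [hgain, h2]
        simp [ht, hh, mul_assoc]
      · have h2 : (G.switchAll s).gain e = g⁻¹ := by
          rw [← h1, GainGraph.orientTo, if_neg (show ¬ (G.switchAll s).head e = v from hh), inv_inv]
        have h3 : e ∈ E' ∩ G.nonloopAt v := ⟨he, hinc, fun h => hh (h.symm.trans ht)⟩
        simp only [hh, h3]
        rw [hgain, h2]
        simp [ht]
      · have h2 : (G.switchAll s).gain e = g := by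
          rw [← h1, GainGraph.orientTo]
          exact (if_pos hh).symm
        have h3 : e ∈ E' ∩ G.nonloopAt v := ⟨he, hinc, fun h => ht (h.trans hh)⟩
        simp only [ht, h3]
        rw [hgain, h2]
        simp [hh, mul_assoc]
      · exact (hinc.elim ht hh).elim
    · have h3 : e ∉ E' ∩ G.nonloopAt v := fun h => he h.1
      rw [hE'1 e he, mul_one] at hgain
      by_cases hl : G.tail e = v ∧ G.head e = v
      · have h1 : G.gain e = 1 := by rw [hgain, hl.1, hl.2, inv_mul_cancel]
        simp [hl, h1]
      · simp only [hl, h3, and_false, if_false]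
        exact hgain

end CountMatroidPaper
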